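/- Fix a real number b with 0 < b < 1. For each integer n ≥ 2, let p(n) denote the smallest prime number greater than or equal to n, and set d(n) = ⌊b·n⌋. Then liminf_{n→∞} p(n)^{d(n)−2} / (2·(n−1)^{d(n)−2}) ≥ e^b / 2. -/

import Mathlib

open Nat Filter

/-- Proposition 6.1: with `p(n)` the smallest prime `≥ n` and `d(n) = ⌊b·n⌋`,
`liminf_n p(n)^(d(n)-2) / (2·(n-1)^(d(n)-2)) ≥ e^b / 2`. -/
theorem liminf_ratio_new_old_ge
    (b : ℝ) (hb0 : 0 < b) (hb1 : b < 1) :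
    Real.exp b / 2 ≤
      Filter.liminf (fun n : ℕ =>
        ((sInf {p : ℕ | p.Prime ∧ n ≤ p} : ℕ) : ℝ) ^ (⌊b * (n : ℝ)⌋₊ - 2) /
          (2 * ((n : ℝ) - 1) ^ (⌊b * (n : ℝ)⌋₊ - 2))) Filter.atTop := by
  have hcob : IsCoboundedUnder (· ≥ ·) atTop (fun n : ℕ =>
        ((sInf {p : ℕ | p.Prime ∧ n ≤ p} : ℕ) : ℝ) ^ (⌊b * (n : ℝ)⌋₊ - 2) /
          (2 * ((n : ℝ) - 1) ^ (⌊b * (n : ℝ)⌋₊ - 2))) := by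
    apply IsCoboundedUnder.of_frequently_le (a := Real.exp 1 / 2)
    rw [frequently_atTop]
    intro N
    obtain ⟨n, hnN, hp⟩ := Nat.exists_infinite_primes N
    refine ⟨n, hnN, ?_⟩
    have hs : sInf {p : ℕ | p.Prime ∧ n ≤ p} = n :=
      le_antisymm (Nat.sInf_le ⟨hp, le_rfl⟩) (le_csInf ⟨n, hp, le_rfl⟩ fun q hq => hq.2)
    rw [hs]
    have hn2 : (2 : ℝ) ≤ n := by exact_mod_cast hp.two_le
    have hpos : (0 : ℝ) < (n : ℝ) - 1 := by linarith
    have hk : ⌊b * (n : ℝ)⌋₊ ≤ n := by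
      apply Nat.floor_le_of_le
      nlinarith
    have hk' : ((⌊b * (n : ℝ)⌋₊ - 2 : ℕ) : ℝ) ≤ (n : ℝ) - 1 := by
      have h1 : (⌊b * (n : ℝ)⌋₊ - 2) + 1 ≤ n := by
        have := hp.two_le
        omega
      have : (((⌊b * (n : ℝ)⌋₊ - 2 : ℕ) : ℝ)) + 1 ≤ n := by exact_mod_cast h1
      linarith
    generalize ⌊b * (n : ℝ)⌋₊ - 2 = k at hk'
    rw [mul_comm, ← div_div, ← div_pow]
    gcongr
    have h1 : (n : ℝ) / ((n : ℝ) - 1) ≤ Real.exp (1 / ((n : ℝ) - 1)) := by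
      have h := Real.add_one_le_exp (1 / ((n : ℝ) - 1))
      have e : (n : ℝ) / ((n : ℝ) - 1) = 1 / ((n : ℝ) - 1) + 1 := by
        field_simp
        ring
      rw [e]; exact h
    calc ((n : ℝ) / ((n : ℝ) - 1)) ^ k ≤ (Real.exp (1 / ((n : ℝ) - 1))) ^ k := by gcongr
      _ = Real.exp (k * (1 / ((n : ℝ) - 1))) := by rw [← Real.exp_nat_mul]
      _ ≤ Real.exp 1 := by
        apply Real.exp_le_exp.mpr
        rw [mul_one_div, div_le_one hpos]
        exact hk'
  have hlim : Tendsto (fun n : ℕ => Real.exp (b - 3 / (n : ℝ)) / 2) atTop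
      (nhds (Real.exp b / 2)) := by
    have h3 : Tendsto (fun n : ℕ => b - 3 / (n : ℝ)) atTop (nhds (b - 0)) :=
      tendsto_const_nhds.sub (tendsto_const_div_atTop_nhds_zero_nat 3)
    rw [sub_zero] at h3
    exact ((Real.continuous_exp.tendsto b).comp h3).div_const 2
  apply le_of_forall_lt
  intro a ha
  obtain ⟨c, hac, hc⟩ := exists_between ha
  refine lt_of_lt_of_le hac (le_liminf_of_le hcob ?_)
  filter_upwards [hlim.eventually (lt_mem_nhds hc), eventually_ge_atTop 2] with n hn hn2'
  refine hn.le.trans ?_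
  have hn2 : (2 : ℝ) ≤ n := by exact_mod_cast hn2'
  have hpos : (0 : ℝ) < (n : ℝ) - 1 := by linarith
  have hs : n ≤ sInf {p : ℕ | p.Prime ∧ n ≤ p} := by
    obtain ⟨q, hq, hqp⟩ := Nat.exists_infinite_primes n
    exact le_csInf ⟨q, hqp, hq⟩ fun q hq => hq.2
  have hs' : (n : ℝ) ≤ (sInf {p : ℕ | p.Prime ∧ n ≤ p} : ℕ) := by exact_mod_cast hs
  generalize ((sInf {p : ℕ | p.Prime ∧ n ≤ p} : ℕ) : ℝ) = P at hs'
  have hk : b * n - 3 ≤ ((⌊b * (n : ℝ)⌋₊ - 2 : ℕ) : ℝ) := by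
    have h1 := Nat.lt_floor_add_one (b * (n : ℝ))
    have h2 : ⌊b * (n : ℝ)⌋₊ ≤ (⌊b * (n : ℝ)⌋₊ - 2) + 2 := by omega
    have h3 : (⌊b * (n : ℝ)⌋₊ : ℝ) ≤ ((⌊b * (n : ℝ)⌋₊ - 2 : ℕ) : ℝ) + 2 := by exact_mod_cast h2
    linarith
  generalize ⌊b * (n : ℝ)⌋₊ - 2 = k at hk
  rw [mul_comm 2, ← div_div, ← div_pow]
  gcongr
  have h1 : Real.exp (1 / (n : ℝ)) ≤ P / ((n : ℝ) - 1) := by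
    have h := Real.add_one_le_exp (-(1 / (n : ℝ)))
    rw [Real.exp_neg] at h
    have hE := Real.exp_pos (1 / (n : ℝ))
    have h2 : (-(1 / (n : ℝ)) + 1) * Real.exp (1 / (n : ℝ)) ≤ 1 := by
      calc _ ≤ (Real.exp (1 / (n : ℝ)))⁻¹ * Real.exp (1 / (n : ℝ)) := by gcongr
        _ = 1 := inv_mul_cancel₀ hE.ne'
    have h3 : (-(1 / (n : ℝ)) + 1) = ((n : ℝ) - 1) / n := by
      field_simp
      ring
    rw [h3, div_mul_eq_mul_div, div_le_one (by linarith)] at h2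
    rw [le_div_iff₀ hpos]
    linarith
  calc Real.exp (b - 3 / (n : ℝ)) ≤ Real.exp (k * (1 / (n : ℝ))) := by
        apply Real.exp_le_exp.mpr
        rw [mul_one_div, le_div_iff₀ (by linarith), sub_mul, div_mul_cancel₀ _ (by linarith)]
        exact hk
    _ = (Real.exp (1 / (n : ℝ))) ^ k := by rw [← Real.exp_nat_mul]
    _ ≤ _ := by gcongr
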